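/- For every natural number k ≥ 1, the evaluation of r k − r (k−1) at −1/2 equals (A^(k−1) + B^(k−1)) / 2^k, where A = 2 + √2 and B = 2 − √2. -/

import Mathlib

open Polynomial

/-- The polynomials `r k ∈ ℤ[X]` defined by `r 0 = 0`, `r 1 = 1`,
`r (k+2) = (1 - 2X) r (k+1) + X r k`. -/
noncomputable def r : ℕ → Polynomial ℤ
  | 0 => 0
  | 1 => 1
  | (k + 2) => (1 - 2 * X) * r (k + 1) + X * r k

noncomputable def A : ℝ := 2 + Real.sqrt 2
noncomputable def B : ℝ := 2 - Real.sqrt 2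

theorem A_sq : A ^ 2 = 4 * A - 2 := by
  have h : Real.sqrt 2 ^ 2 = 2 := Real.sq_sqrt (by norm_num)
  unfold A
  linear_combination h

theorem B_sq : B ^ 2 = 4 * B - 2 := by
  have h : Real.sqrt 2 ^ 2 = 2 := Real.sq_sqrt (by norm_num)
  unfold B
  linear_combination h

theorem aeval_r_add_two (n : ℕ) :
    aeval (-1 / 2 : ℝ) (r (n + 2)) =
      2 * aeval (-1 / 2 : ℝ) (r (n + 1)) - aeval (-1 / 2 : ℝ) (r n) / 2 := by
  simp only [r, map_add, map_mul, map_sub, map_one, aeval_X, map_ofNat]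
  ring

theorem aeval_r_succ_sub (n : ℕ) :
    aeval (-1 / 2 : ℝ) (r (n + 1)) - aeval (-1 / 2 : ℝ) (r n) =
      (A ^ n + B ^ n) / 2 ^ (n + 1) := by
  induction n using Nat.twoStepInduction with
  | zero => norm_num [r]
  | one =>
    rw [aeval_r_add_two]
    norm_num [r, A, B]
  | more n ih₀ ih₁ =>
    have hA : A ^ (n + 2) = A ^ n * (4 * A - 2) := by rw [pow_add, A_sq]
    have hB : B ^ (n + 2) = B ^ n * (4 * B - 2) := by rw [pow_add, B_sq]
    have h₁ := aeval_r_add_two (n + 1)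
    have h₀ := aeval_r_add_two n
    calc
      _ = 2 * ((A ^ (n + 1) + B ^ (n + 1)) / 2 ^ (n + 2)) -
          (A ^ n + B ^ n) / 2 ^ (n + 1) / 2 := by
        linear_combination h₁ - h₀ + 2 * ih₁ - ih₀ / 2
      _ = _ := by
        rw [hA, hB]
        field_simp
        ring

/-- For `k ≥ 1`, the evaluation of `r k - r (k-1)` at `-1/2` equals
`(A^(k-1) + B^(k-1)) / 2^k`. -/
theorem r_sub_eval_neg_half (k : ℕ) (hk : 1 ≤ k) :
    (Polynomial.aeval (-1 / 2 : ℝ) (r k - r (k - 1))) =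
      (A ^ (k - 1) + B ^ (k - 1)) / 2 ^ k := by
  obtain ⟨n, rfl⟩ := Nat.exists_eq_add_of_le' hk
  rw [map_sub, Nat.add_sub_cancel, aeval_r_succ_sub]
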